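/- Assume γ_i > 0 for every i = 1,…,m, α ∈ (1,2), and p ∈ [1,α). Then there exist δ ∈ (0,1] and positive constants κ̃₀ and κ̃₁ such that ⟨b(x,u), ∇V_p(x)⟩ + I_α V_p(x) ≤ κ̃₀ - κ̃₁ V_p(x) for all x ∈ ℝ^m and all u ∈ Δ. -/

import Mathlib

open scoped BigOperators
open MeasureTheory

noncomputable section

/-- The piecewise function `ψ` from Definition 1 of the paper. -/
def psi (t : ℝ) : ℝ :=
  if t ≤ -1 then -(1/2)
  else if t ≤ 0 then (t+1)^3 - (1/2)*(t+1)^4 - 1/2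
  else t

/-- `Ψ(x) = ∑ i, ψ(x_i)/μ_i`. -/
def Psi (m : ℕ) (μ : Fin m → ℝ) (x : Fin m → ℝ) : ℝ := ∑ i, psi (x i) / μ i

/-- The Lyapunov function `V_p(x) = (δ Ψ(-x) + Ψ(x) + m / min_i μ_i)^p`. -/
def Vp (m : ℕ) (μ : Fin m → ℝ) (δ p : ℝ) (x : Fin m → ℝ) : ℝ :=
  (δ * Psi m μ (-x) + Psi m μ x + (m : ℝ) / ⨅ i, μ i) ^ p

/-- The drift `b(x,u) = -(β/m) M e - M (x - ⟨e,x⟩⁺ u) - ⟨e,x⟩⁺ Γ u`, written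
componentwise, where `M = diag(μ)` and `Γ = diag(γ)`. -/
def drift (m : ℕ) (μ γ : Fin m → ℝ) (β : ℝ) (x u : Fin m → ℝ) : Fin m → ℝ :=
  fun i => -(β / (m : ℝ)) * μ i - μ i * (x i - max (∑ j, x j) 0 * u i)
    - max (∑ j, x j) 0 * (γ i * u i)

/-- The anisotropic `α`-stable non-local operator
`I_α f(x) = ∑ i, ξ_i ∫_{ℝ∖{0}} (f(x + y e_i) - f(x) - y ∂_i f(x)) |y|^{-(1+α)} dy`. -/
def Ialpha (m : ℕ) (α : ℝ) (ξ : Fin m → ℝ) (f : (Fin m → ℝ) → ℝ)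
    (x : Fin m → ℝ) : ℝ :=
  ∑ i, ξ i * ∫ y : ℝ,
    (f (x + Pi.single i y) - f x - y * fderiv ℝ f x (Pi.single i 1)) / |y| ^ (1 + α)

/-- Absolute convergence of the integrals defining `I_α f(x)`. -/
def IalphaConv (m : ℕ) (α : ℝ) (f : (Fin m → ℝ) → ℝ) (x : Fin m → ℝ) : Prop :=
  ∀ i : Fin m, Integrable (fun y : ℝ =>
    (f (x + Pi.single i y) - f x - y * fderiv ℝ f x (Pi.single i 1)) / |y| ^ (1 + α))

/-- The Euclidean norm on `ℝ^m`. -/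
def eucNorm (m : ℕ) (x : Fin m → ℝ) : ℝ := Real.sqrt (∑ i, x i ^ 2)


def dpsi (t : ℝ) : ℝ :=
  if t ≤ -1 then 0
  else if t ≤ 0 then 3*(t+1)^2 - 2*(t+1)^3
  else 1

lemma hasDerivAt_psi (t : ℝ) : HasDerivAt psi (dpsi t) t := by
  have hq : ∀ s : ℝ, HasDerivAt (fun t : ℝ => (t+1)^3 - (1/2)*(t+1)^4 - 1/2)
      (3*(s+1)^2 - 2*(s+1)^3) s := by
    intro s
    have h1 : HasDerivAt (fun t : ℝ => t + 1) 1 s := (hasDerivAt_id s).add_const 1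
    have := ((h1.pow 3).sub ((h1.pow 4).const_mul (1/2 : ℝ))).sub_const (1/2)
    exact this.congr_deriv (by norm_num; ring)
  rcases lt_trichotomy t (-1) with h | h | h
  · have : dpsi t = 0 := by simp [dpsi, h.le]
    rw [this]
    refine (hasDerivAt_const t (-(1/2) : ℝ)).congr_of_eventuallyEq ?_
    filter_upwards [Iio_mem_nhds h] with s hs
    simp only [Set.mem_Iio] at hs
    simp [psi, hs.le]
  · have h0 : dpsi t = 0 := by simp [dpsi, h.le]
    rw [h0]
    have hl : HasDerivWithinAt psi 0 (Set.Iic t) t := by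
      refine (hasDerivWithinAt_const t _ (-(1/2) : ℝ)).congr ?_ ?_
      · intro s hs
        simp only [Set.mem_Iic] at hs
        simp [psi, hs.trans h.le]
      · simp [psi, h.le]
    have hr : HasDerivWithinAt psi 0 (Set.Icc t 0) t := by
      have h2 := (hq t).hasDerivWithinAt (s := Set.Icc t 0)
      rw [h] at h2 ⊢
      rw [show (3*((-1:ℝ)+1)^2 - 2*((-1)+1)^3) = 0 by norm_num] at h2
      refine h2.congr ?_ ?_
      · intro s hs
        rcases eq_or_lt_of_le hs.1 with h3 | h3
        · rw [← h3]; norm_num [psi]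
        · simp [psi, not_le.2 h3, hs.2]
      · norm_num [psi]
    have := hl.union hr
    refine this.hasDerivAt ?_
    rw [Set.Iic_union_Icc_eq_Iic (by rw [h]; norm_num)]
    exact Iic_mem_nhds (by rw [h]; norm_num)
  · rcases lt_trichotomy t 0 with h' | h' | h'
    · have : dpsi t = 3*(t+1)^2 - 2*(t+1)^3 := by simp [dpsi, not_le.2 h, h'.le]
      rw [this]
      refine (hq t).congr_of_eventuallyEq ?_
      filter_upwards [Ioo_mem_nhds h h'] with s hs
      simp [psi, not_le.2 hs.1, hs.2.le]
    · subst h'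
      have h0 : dpsi 0 = 1 := by norm_num [dpsi]
      rw [h0]
      have hl : HasDerivWithinAt psi 1 (Set.Ici 0) 0 := by
        refine (hasDerivWithinAt_id (0:ℝ) _).congr ?_ ?_
        · intro s hs
          simp only [Set.mem_Ici] at hs
          rcases eq_or_lt_of_le hs with h3 | h3
          · rw [← h3]; norm_num [psi]
          · have : ¬ s ≤ -1 := by linarith
            simp [psi, not_le.2 h3, this]
        · norm_num [psi]
      have hr : HasDerivWithinAt psi 1 (Set.Ioc (-1) 0) 0 := by
        have h2 := (hq 0).hasDerivWithinAt (s := Set.Ioc (-1) 0)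
        rw [show (3*((0:ℝ)+1)^2 - 2*(0+1)^3) = 1 by norm_num] at h2
        refine h2.congr ?_ ?_
        · intro s hs
          simp [psi, not_le.2 hs.1, hs.2]
        · norm_num [psi]
      have := hr.union hl
      refine this.hasDerivAt ?_
      rw [Set.Ioc_union_Ici_eq_Ioi (by norm_num)]
      exact Ioi_mem_nhds (by norm_num)
    · have : dpsi t = 1 := by simp [dpsi, not_le.2 h, not_le.2 h']
      rw [this]
      refine (hasDerivAt_id t).congr_of_eventuallyEq ?_
      filter_upwards [Ioi_mem_nhds h'] with s hs
      simp only [Set.mem_Ioi] at hs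
      have : ¬ s ≤ -1 := by linarith
      simp [psi, this, not_le.2 hs]

lemma dpsi_nonneg (t : ℝ) : 0 ≤ dpsi t := by
  unfold dpsi
  split_ifs with h h'
  · exact le_rfl
  · have : 0 ≤ (t+1)^2 * (1 - 2*t) := by
      apply mul_nonneg (sq_nonneg _); linarith
    nlinarith
  · norm_num

lemma dpsi_le_one (t : ℝ) : dpsi t ≤ 1 := by
  unfold dpsi
  split_ifs with h h'
  · norm_num
  · push Not at h
    have : 0 ≤ t^2 * (3 + 2*t) := by
      apply mul_nonneg (sq_nonneg _); linarith
    nlinarith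
  · norm_num

def clp (t : ℝ) : ℝ := max 0 (min 1 (t+1))

lemma dpsi_eq (t : ℝ) : dpsi t = 3 * clp t ^2 - 2 * clp t ^ 3 := by
  unfold dpsi clp
  split_ifs with h h'
  · rw [max_eq_left (by rw [min_le_iff]; right; linarith)]; norm_num
  · rw [min_eq_right (by linarith), max_eq_right (by linarith)]
  · rw [min_eq_left (by linarith), max_eq_right (by linarith)]; norm_num

lemma dpsi_lip (s t : ℝ) : |dpsi s - dpsi t| ≤ 6 * |s - t| := by
  have h1 : |clp s - clp t| ≤ |s - t| := by
    unfold clp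
    refine (abs_max_sub_max_le_max 0 (min 1 (s+1)) 0 (min 1 (t+1))).trans ?_
    refine max_le (by simp) ?_
    refine (abs_min_sub_min_le_max 1 (s+1) 1 (t+1)).trans ?_
    refine max_le (by simp) ?_
    simp
  have b : ∀ t, 0 ≤ clp t ∧ clp t ≤ 1 := fun t => ⟨le_max_left _ _, by simp [clp]⟩
  obtain ⟨a1, a2⟩ := b s
  obtain ⟨b1, b2⟩ := b t
  rw [dpsi_eq, dpsi_eq]
  have : 3 * clp s ^2 - 2 * clp s ^ 3 - (3 * clp t ^2 - 2 * clp t ^ 3) =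
    (3 * (clp s + clp t) - 2 * (clp s ^2 + clp s * clp t + clp t^2)) * (clp s - clp t) := by ring
  rw [this, abs_mul]
  apply mul_le_mul _ h1 (abs_nonneg _) (by norm_num)
  rw [abs_le]
  constructor <;> nlinarith [mul_nonneg a1 b1]

lemma psi_ge (t : ℝ) : -(1/2) ≤ psi t := by
  unfold psi
  split_ifs with h h'
  · exact le_rfl
  · push Not at h
    have : 0 ≤ (t+1)^3 * (1 - t) := by
      apply mul_nonneg (pow_nonneg (by linarith) _); linarith
    nlinarith
  · linarith

lemma psi_nonneg {t : ℝ} (ht : 0 ≤ t) : psi t = t := by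
  unfold psi
  split_ifs with h h'
  · linarith
  · have : t = 0 := le_antisymm h' ht
    rw [this]; norm_num
  · rfl

lemma psi_le (t : ℝ) : psi t ≤ max t 0 := by
  rcases le_total 0 t with h | h
  · rw [psi_nonneg h]; exact le_max_left _ _
  · refine le_trans ?_ (le_max_right _ _)
    have := psi_nonneg (le_refl 0)
    unfold psi
    split_ifs with h1
    · norm_num
    · push Not at h1
      have : 0 ≤ (t+1) ^ 3 := pow_nonneg (by linarith) _
      have h3 : (t+1)^3 ≤ 1 := pow_le_one₀ (by linarith) (by linarith)
      nlinarith [mul_nonneg this (neg_nonneg.2 h), sq_nonneg t, sq_nonneg (t+1), sq_nonneg (t*(t+1))]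

lemma mul_dpsi_ge (t : ℝ) : max t 0 - 1 ≤ t * dpsi t := by
  have h0 := dpsi_nonneg t
  have h1 := dpsi_le_one t
  rcases lt_or_ge 0 t with h | h
  · have : dpsi t = 1 := by
      unfold dpsi
      rw [if_neg (by linarith), if_neg (by linarith)]
    rw [this, max_eq_left h.le]; linarith
  · rw [max_eq_right h]
    rcases le_or_gt t (-1) with h2 | h2
    · have : dpsi t = 0 := by simp [dpsi, h2]
      rw [this]; norm_num
    · nlinarith

def gf (δ t : ℝ) : ℝ := δ * psi (-t) + psi t
def dgf (δ t : ℝ) : ℝ := dpsi t - δ * dpsi (-t)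

lemma hasDerivAt_gf (δ t : ℝ) : HasDerivAt (gf δ) (dgf δ t) t := by
  have h := (((hasDerivAt_psi (-t)).comp t (hasDerivAt_neg t)).const_mul δ).add (hasDerivAt_psi t)
  exact h.congr_deriv (by unfold dgf; ring)

lemma gf_ge {δ : ℝ} (h0 : 0 < δ) (h1 : δ ≤ 1) (t : ℝ) : -(1/2) ≤ gf δ t := by
  unfold gf
  rcases le_total 0 t with h | h
  · have := psi_ge (-t)
    rw [psi_nonneg h]; nlinarith
  · have := psi_ge t
    rw [psi_nonneg (neg_nonneg.2 h)]; nlinarith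

lemma gf_le {δ : ℝ} (h0 : 0 < δ) (t : ℝ) : gf δ t ≤ max t 0 + δ * max (-t) 0 := by
  unfold gf
  nlinarith [psi_le t, psi_le (-t)]

lemma dgf_le {δ : ℝ} (h0 : 0 < δ) (t : ℝ) : dgf δ t ≤ 1 := by
  unfold dgf; nlinarith [dpsi_le_one t, dpsi_nonneg (-t)]

lemma dgf_ge {δ : ℝ} (h0 : 0 < δ) (t : ℝ) : -δ ≤ dgf δ t := by
  unfold dgf; nlinarith [dpsi_nonneg t, dpsi_le_one (-t)]

lemma dgf_abs {δ : ℝ} (h0 : 0 < δ) (h1 : δ ≤ 1) (t : ℝ) : |dgf δ t| ≤ 1 := by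
  rw [abs_le]; exact ⟨by linarith [dgf_ge h0 t], dgf_le h0 t⟩

lemma dgf_lip {δ : ℝ} (h0 : 0 < δ) (h1 : δ ≤ 1) (s t : ℝ) : |dgf δ s - dgf δ t| ≤ 12 * |s - t| := by
  unfold dgf
  have a := dpsi_lip s t
  have b := dpsi_lip (-s) (-t)
  have e : |(-s) - (-t)| = |s - t| := by rw [← abs_neg]; ring_nf
  rw [e] at b
  rw [abs_le] at *
  constructor <;> nlinarith [a.1, a.2, b.1, b.2, abs_nonneg (s-t)]

lemma mul_dgf {δ : ℝ} (h0 : 0 < δ) (h1 : δ ≤ 1) (t : ℝ) :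
    -(t * dgf δ t) ≤ 2 - (max t 0 + δ * max (-t) 0) := by
  unfold dgf
  nlinarith [mul_dpsi_ge t, mul_dpsi_ge (-t)]

lemma gf_diff {δ : ℝ} (h0 : 0 < δ) (h1 : δ ≤ 1) (t y : ℝ) : |gf δ (t + y) - gf δ t| ≤ |y| := by
  have := Convex.norm_image_sub_le_of_norm_hasDerivWithin_le (f := gf δ) (f' := dgf δ) (C := 1)
    (s := Set.univ) (x := t) (y := t + y) (fun s _ => (hasDerivAt_gf δ s).hasDerivWithinAt)
    (fun s _ => dgf_abs h0 h1 s) convex_univ (Set.mem_univ _) (Set.mem_univ _)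
  simpa using this

lemma gf_taylor {δ : ℝ} (h0 : 0 < δ) (h1 : δ ≤ 1) (t y : ℝ) :
    |gf δ (t + y) - gf δ t - y * dgf δ t| ≤ 12 * y ^ 2 := by
  have := Convex.norm_image_sub_le_of_norm_hasDerivWithin_le
    (f := fun s => gf δ s - s * dgf δ t) (f' := fun s => dgf δ s - 1 * dgf δ t) (C := 12 * |y|)
    (s := Set.uIcc t (t+y)) (x := t) (y := t + y)
    (fun s _ => ((hasDerivAt_gf δ s).sub ((hasDerivAt_id s).mul_const _)).hasDerivWithinAt)
    (fun s hs => by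
      rw [one_mul, Real.norm_eq_abs]
      refine (dgf_lip h0 h1 s t).trans ?_
      have := Set.abs_sub_left_of_mem_uIcc hs
      simp only [add_sub_cancel_left] at this
      linarith) (convex_uIcc _ _) Set.left_mem_uIcc Set.right_mem_uIcc
  simp only [add_sub_cancel_left, Real.norm_eq_abs] at this
  have e : 12 * |y| * |y| = 12 * y ^ 2 := by rw [mul_assoc, abs_mul_abs_self]; ring
  rw [e] at this
  convert this using 2
  ring

lemma rpow_taylor_sq {p w a : ℝ} (hp1 : 1 ≤ p) (hp2 : p ≤ 2) (hw : 0 < w) (ha : 0 < w + a) :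
    (w + a) ^ p ≤ w ^ p + p * w ^ (p-1) * a + w ^ (p-2) * a ^ 2 := by
  have hz : -1 ≤ a / w := by rw [le_div_iff₀ hw]; linarith
  have hb := rpow_one_add_le_one_add_mul_self hz (p := p - 1) (by linarith) (by linarith)
  have hz1 : 0 < 1 + a / w := by
    have : 1 + a / w = (w + a) / w := by field_simp
    rw [this]; positivity
  have e1 : w + a = w * (1 + a / w) := by field_simp
  have e2 : (1 + a / w) ^ p = (1 + a / w) ^ (p - 1) * (1 + a / w) := by
    rw [← Real.rpow_add_one hz1.ne']; congr 1; ring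
  have e3 : w ^ (p-1) = w ^ p / w := by rw [Real.rpow_sub_one hw.ne']
  have e4 : w ^ (p-2) = w ^ p / w ^ 2 := by
    rw [Real.rpow_sub hw]; norm_num
  have hwp : 0 < w ^ p := Real.rpow_pos_of_pos hw p
  calc (w + a) ^ p = w ^ p * ((1 + a / w) ^ (p - 1) * (1 + a / w)) := by
        rw [← e2, ← Real.mul_rpow hw.le hz1.le, ← e1]
    _ ≤ w ^ p * ((1 + (p-1) * (a / w)) * (1 + a / w)) := by gcongr
    _ = w ^ p * (1 + p * (a / w) + (p - 1) * (a/w)^2) := by ring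
    _ ≤ w ^ p * (1 + p * (a / w) + 1 * (a/w)^2) := by gcongr; linarith
    _ = _ := by rw [e3, e4]; field_simp

lemma rpow_taylor_p {p w a : ℝ} (hp1 : 1 ≤ p) (hp2 : p ≤ 2) (hw : 0 < w) (ha : 0 < w + a) :
    (w + a) ^ p ≤ w ^ p + p * w ^ (p-1) * a + 2 * |a| ^ p := by
  rcases le_or_gt |a| w with h | h
  · refine (rpow_taylor_sq hp1 hp2 hw ha).trans ?_
    have : w ^ (p-2) * a ^ 2 ≤ |a| ^ p := by
      rcases eq_or_ne a 0 with h0 | h0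
      · subst h0; simp; positivity
      · have hpos : 0 < |a| := abs_pos.2 h0
        have : w ^ (p-2) ≤ |a| ^ (p-2) := Real.rpow_le_rpow_of_nonpos hpos h (by linarith)
        calc w ^ (p-2) * a ^ 2 ≤ |a| ^ (p-2) * a ^ 2 := by gcongr
          _ = |a| ^ p := by
            rw [← sq_abs, ← Real.rpow_natCast, ← Real.rpow_add hpos]; norm_num
    have h0 : 0 ≤ |a| ^ p := by positivity
    linarith
  · have hapos : 0 < a := by
      by_contra hc
      rw [abs_of_nonpos (not_lt.1 hc)] at h; linarith
    rw [abs_of_pos hapos] at h ⊢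
    have e2 : (w + a) ^ p = (w + a) ^ (p - 1) * (w + a) := by
      rw [← Real.rpow_add_one ha.ne']; congr 1; ring
    have e3 : w ^ p = w ^ (p - 1) * w := by
      rw [← Real.rpow_add_one hw.ne']; congr 1; ring
    have e4 : a ^ p = a ^ (p - 1) * a := by
      rw [← Real.rpow_add_one hapos.ne']; congr 1; ring
    have hs : (w + a) ^ (p-1) ≤ w ^ (p-1) + a ^ (p-1) :=
      Real.rpow_add_le_add_rpow hw.le hapos.le (by linarith) (by linarith)
    rw [e2, e3, e4]
    have hA : 0 ≤ w ^ (p-1) := by positivity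
    have hB : 0 ≤ a ^ (p-1) := by positivity
    nlinarith [mul_le_mul_of_nonneg_right hs ha.le, mul_nonneg hA hapos.le,
      mul_le_mul_of_nonneg_left h.le hB, mul_nonneg (mul_nonneg (sub_nonneg.2 hp1) hA) hapos.le]

def qf (α p y : ℝ) : ℝ :=
  (Set.Ioc (0:ℝ) 1).indicator (fun y => y ^ (1 - α)) y +
    (Set.Ioi (1:ℝ)).indicator (fun y => y ^ (p - 1 - α)) y

def Hf (α p y : ℝ) : ℝ := qf α p y + qf α p (-y)

lemma qf_nonneg (α p y : ℝ) : 0 ≤ qf α p y := by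
  unfold qf
  apply add_nonneg
  · apply Set.indicator_nonneg
    intro y hy; have := hy.1; positivity
  · apply Set.indicator_nonneg
    intro y hy
    have : (0:ℝ) < y := lt_trans one_pos hy
    positivity

lemma Hf_nonneg (α p y : ℝ) : 0 ≤ Hf α p y := add_nonneg (qf_nonneg _ _ _) (qf_nonneg _ _ _)

lemma integrable_Hf {α p : ℝ} (h2 : α < 2) (hp : p < α) : Integrable (Hf α p) := by
  have hq : Integrable (qf α p) := by
    apply Integrable.add
    · rw [integrable_indicator_iff measurableSet_Ioc]
      have := intervalIntegral.intervalIntegrable_rpow' (a := 0) (b := 1) (r := 1 - α) (by linarith)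
      rwa [intervalIntegrable_iff_integrableOn_Ioc_of_le zero_le_one] at this
    · rw [integrable_indicator_iff measurableSet_Ioi]
      exact integrableOn_Ioi_rpow_of_lt (by linarith) one_pos
  exact hq.add hq.comp_neg

lemma Hf_abs (α p : ℝ) {y : ℝ} (hy : y ≠ 0) :
    Hf α p y = if |y| ≤ 1 then |y| ^ (1 - α) else |y| ^ (p - 1 - α) := by
  have key : ∀ y : ℝ, 0 < y → Hf α p y = if y ≤ 1 then y ^ (1 - α) else y ^ (p - 1 - α) := by
    intro y hy
    have h1 : ¬ (0 < -y) := by linarith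
    have h2 : ¬ (1 < -y) := by linarith
    by_cases h : y ≤ 1
    · simp [Hf, qf, Set.indicator, h, hy, not_lt.2 h, hy.le, not_lt.2 hy.le, h2]
    · simp [Hf, qf, Set.indicator, h, hy, not_le.1 h, not_lt.2 hy.le, h2]
  rcases lt_or_gt_of_ne hy with h | h
  · rw [abs_of_neg h, ← key (-y) (by linarith)]
    simp [Hf, add_comm]
  · rw [abs_of_pos h, ← key y h]

lemma int_bound {α p D : ℝ} (h2 : α < 2) (hpα : p < α) (hD : 0 ≤ D) (N : ℝ → ℝ)
    (hN2 : ∀ y, |y| ≤ 1 → N y ≤ D * |y| ^ 2) (hNp : ∀ y, 1 < |y| → N y ≤ D * |y| ^ p) :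
    ∫ y : ℝ, N y / |y| ^ (1 + α) ≤ D * ∫ y, Hf α p y := by
  rw [← integral_const_mul]
  by_cases hi : Integrable (fun y => N y / |y| ^ (1 + α))
  · apply integral_mono_ae hi ((integrable_Hf h2 hpα).const_mul D)
    have h0 : ∀ᵐ y : ℝ, y ≠ 0 := by simp [ae_iff]
    filter_upwards [h0] with y hy
    have hpos : 0 < |y| := abs_pos.2 hy
    rw [Hf_abs α p hy]
    rw [div_le_iff₀ (Real.rpow_pos_of_pos hpos _), mul_assoc]
    split_ifs with h
    · rw [← Real.rpow_add hpos, show 1 - α + (1 + α) = ((2:ℕ):ℝ) by push_cast; ring, Real.rpow_natCast]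
      exact hN2 y h
    · rw [← Real.rpow_add hpos, show p - 1 - α + (1 + α) = p by ring]
      exact hNp y (not_le.1 h)
  · rw [integral_undef hi]
    exact integral_nonneg fun y => mul_nonneg hD (Hf_nonneg _ _ _)

def Wf (m : ℕ) (μ : Fin m → ℝ) (δ : ℝ) (x : Fin m → ℝ) : ℝ :=
  ∑ i, gf δ (x i) / μ i + (m : ℝ) / ⨅ i, μ i

lemma Vp_eq (m : ℕ) (μ : Fin m → ℝ) (δ p : ℝ) :
    Vp m μ δ p = fun x => (Wf m μ δ x) ^ p := by
  funext x
  unfold Vp Wf Psi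
  congr 2
  rw [Finset.mul_sum, ← Finset.sum_add_distrib]
  refine Finset.sum_congr rfl fun i _ => ?_
  simp only [gf, Pi.neg_apply]; ring

lemma lam_le {m : ℕ} (hm : 1 ≤ m) {μ : Fin m → ℝ} (hμ : ∀ i, 0 < μ i) :
    ∑ i, 1 / μ i ≤ (m : ℝ) / ⨅ i, μ i := by
  haveI : Nonempty (Fin m) := ⟨⟨0, hm⟩⟩
  obtain ⟨i0, hi0⟩ := exists_eq_ciInf_of_finite (f := μ)
  have hpos : 0 < ⨅ i, μ i := hi0 ▸ hμ i0
  calc ∑ i, 1 / μ i ≤ ∑ _i : Fin m, 1 / (⨅ i, μ i) := by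
        refine Finset.sum_le_sum fun i _ => ?_
        exact one_div_le_one_div_of_le hpos (ciInf_le (Set.finite_range μ).bddBelow i)
    _ = _ := by simp [div_eq_mul_inv]

lemma Wf_ge {m : ℕ} (hm : 1 ≤ m) {μ : Fin m → ℝ} (hμ : ∀ i, 0 < μ i) {δ : ℝ} (h0 : 0 < δ)
    (h1 : δ ≤ 1) (x : Fin m → ℝ) : (∑ i, 1 / μ i) / 2 ≤ Wf m μ δ x := by
  unfold Wf
  have h := lam_le hm hμ
  have : -((∑ i, 1 / μ i) / 2) ≤ ∑ i, gf δ (x i) / μ i := by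
    rw [Finset.sum_div, ← Finset.sum_neg_distrib]
    refine Finset.sum_le_sum fun i _ => ?_
    rw [le_div_iff₀ (hμ i)]
    have := gf_ge h0 h1 (x i)
    have e : -(1 / μ i / 2) * μ i = -(1/2) := by have := (hμ i).ne'; field_simp
    rw [e]; exact this
  linarith

lemma hasFDerivAt_Vp {m : ℕ} {μ : Fin m → ℝ} {δ p : ℝ} (x : Fin m → ℝ) (hW : 0 < Wf m μ δ x)
    (v : Fin m → ℝ) : fderiv ℝ (Vp m μ δ p) x v =
      p * (Wf m μ δ x) ^ (p-1) * ∑ i, dgf δ (x i) / μ i * v i := by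
  have h1 : HasFDerivAt (Wf m μ δ)
      (∑ i, (dgf δ (x i) / μ i) • (ContinuousLinearMap.proj i : (Fin m → ℝ) →L[ℝ] ℝ)) x := by
    unfold Wf
    apply HasFDerivAt.add_const
    apply HasFDerivAt.fun_sum
    intro i _
    have hp : HasFDerivAt (fun x : Fin m → ℝ => x i)
      (ContinuousLinearMap.proj i : (Fin m → ℝ) →L[ℝ] ℝ) x := hasFDerivAt_apply i x
    exact ((hasDerivAt_gf δ (x i)).div_const (μ i)).comp_hasFDerivAt x hp
  have h2 := h1.rpow_const (p := p) (Or.inl hW.ne')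
  rw [Vp_eq, h2.fderiv]
  simp [ContinuousLinearMap.sum_apply]

lemma Wf_single {m : ℕ} {μ : Fin m → ℝ} {δ : ℝ} (x : Fin m → ℝ) (i : Fin m) (y : ℝ) :
    Wf m μ δ (x + Pi.single i y) = Wf m μ δ x + (gf δ (x i + y) - gf δ (x i)) / μ i := by
  unfold Wf
  have : ∑ j, gf δ ((x + Pi.single i y : Fin m → ℝ) j) / μ j - ∑ j, gf δ (x j) / μ j =
      (gf δ (x i + y) - gf δ (x i)) / μ i := by
    rw [← Finset.sum_sub_distrib, Finset.sum_eq_single i]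
    · simp only [Pi.add_apply, Pi.single_eq_same]; ring
    · intro j _ hj
      simp [hj]
    · simp
  linarith

lemma Ialpha_le {m : ℕ} (hm : 1 ≤ m) {μ ξ : Fin m → ℝ} (hμ : ∀ i, 0 < μ i) (hξ : ∀ i, 0 < ξ i)
    {α p δ : ℝ} (h2 : α < 2) (hp1 : 1 ≤ p) (hpα : p < α) (h0 : 0 < δ) (h1 : δ ≤ 1) :
    ∃ K : ℝ, 0 ≤ K ∧ ∀ x, Ialpha m α ξ (Vp m μ δ p) x ≤ K * (1 + Wf m μ δ x ^ (p-1)) := by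
  set Lam := ∑ i, 1 / μ i with hLam
  have hle : ∀ i, 1 / μ i ≤ Lam := fun i =>
    Finset.single_le_sum (f := fun i => 1 / μ i) (fun j _ => (one_div_pos.2 (hμ j)).le) (Finset.mem_univ i)
  have hLpos : 0 < Lam := lt_of_lt_of_le (one_div_pos.2 (hμ ⟨0, hm⟩)) (hle _)
  set K := (Lam / 2) ^ (p-2) * Lam ^ 2 + 24 * Lam + 2 * Lam ^ p with hK
  have hKpos : 0 ≤ K := by positivity
  have hI : 0 ≤ ∫ y, Hf α p y := integral_nonneg fun y => Hf_nonneg _ _ _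
  refine ⟨∑ i, ξ i * (K * ∫ y, Hf α p y), Finset.sum_nonneg fun i _ =>
    mul_nonneg (hξ i).le (mul_nonneg hKpos hI), fun x => ?_⟩
  have hWge := Wf_ge hm hμ h0 h1 x
  rw [← hLam] at hWge
  have hW : 0 < Wf m μ δ x := by linarith
  unfold Ialpha
  rw [Finset.sum_mul]
  refine Finset.sum_le_sum fun i _ => ?_
  rw [mul_assoc]
  refine mul_le_mul_of_nonneg_left ?_ (hξ i).le
  have hWp : 0 ≤ Wf m μ δ x ^ (p-1) := by positivity
  have main := int_bound h2 hpα (D := K * (1 + Wf m μ δ x ^ (p-1))) (by positivity)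
    (fun y => Vp m μ δ p (x + Pi.single i y) - Vp m μ δ p x
      - y * fderiv ℝ (Vp m μ δ p) x (Pi.single i 1)) ?_ ?_
  · refine main.trans (le_of_eq (by ring))
  all_goals
    intro y hy
    rw [hasFDerivAt_Vp x hW]
    have es : ∑ j, dgf δ (x j) / μ j * (Pi.single i (1:ℝ) : Fin m → ℝ) j = dgf δ (x i) / μ i := by
      simp [Pi.single_apply]
    rw [es, Vp_eq]
    simp only
    rw [Wf_single]
    have hWy := Wf_ge hm hμ h0 h1 (x + Pi.single i y)
    rw [Wf_single, ← hLam] at hWy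
    have hL := hle i
    have hLi : 0 < 1 / μ i := one_div_pos.2 (hμ i)
    have hd := gf_diff h0 h1 (x i) y
    have ht := (abs_le.1 (gf_taylor h0 h1 (x i) y)).2
    have hdg := dgf_abs h0 h1 (x i)
    set W := Wf m μ δ x
    set a := (gf δ (x i + y) - gf δ (x i)) / μ i with ha
    have haabs : |a| ≤ Lam * |y| := by
      rw [ha, div_eq_mul_one_div, abs_mul, abs_of_pos hLi, mul_comm]
      exact mul_le_mul hL hd (abs_nonneg _) hLpos.le
    have hWa : 0 < W + a := by linarith
  · have hts := rpow_taylor_sq hp1 (by linarith) hW hWa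
    have hw2 : W ^ (p-2) ≤ (Lam/2) ^ (p-2) :=
      Real.rpow_le_rpow_of_nonpos (by positivity) hWge (by linarith)
    have ha2 : a ^ 2 ≤ Lam ^ 2 * |y| ^ 2 := by
      rw [← sq_abs a, ← mul_pow]; gcongr
    have hA : W ^ (p-2) * a ^ 2 ≤ (Lam/2) ^ (p-2) * (Lam ^ 2 * |y| ^ 2) := by gcongr
    have hB : a - y * (dgf δ (x i) / μ i) ≤ 12 * Lam * |y| ^ 2 := by
      have : a - y * (dgf δ (x i) / μ i) =
          (gf δ (x i + y) - gf δ (x i) - y * dgf δ (x i)) * (1 / μ i) := by rw [ha]; ring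
      rw [this, sq_abs]
      calc _ ≤ 12 * y ^ 2 * (1 / μ i) := by gcongr
        _ ≤ 12 * y ^ 2 * Lam := by gcongr
        _ = _ := by ring
    have hC : p * W ^ (p-1) * (a - y * (dgf δ (x i) / μ i)) ≤ 2 * W ^ (p-1) * (12 * Lam * |y| ^ 2) := by
      calc _ ≤ p * W ^ (p-1) * (12 * Lam * |y| ^ 2) := by gcongr
        _ ≤ _ := by gcongr; linarith
    have hy2 : 0 ≤ |y| ^ 2 := by positivity
    have t1 : 0 ≤ ((Lam / 2) ^ (p-2) * Lam ^ 2 + 2 * Lam ^ p) * W ^ (p-1) * |y|^2 := by positivity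
    have t2 : 0 ≤ (24 * Lam + 2 * Lam ^ p) * |y|^2 := by positivity
    rw [hK]
    linarith
  · have hts := rpow_taylor_p hp1 (by linarith) hW hWa
    have hap : |a| ^ p ≤ Lam ^ p * |y| ^ p := by
      rw [← Real.mul_rpow hLpos.le (abs_nonneg _)]
      exact Real.rpow_le_rpow (abs_nonneg _) haabs (by linarith)
    have hyy : |y| ≤ |y| ^ p := by
      conv_lhs => rw [← Real.rpow_one |y|]
      exact Real.rpow_le_rpow_of_exponent_le hy.le hp1
    have hB : a - y * (dgf δ (x i) / μ i) ≤ 2 * Lam * |y| ^ p := by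
      have e1 : |y * (dgf δ (x i) / μ i)| ≤ Lam * |y| := by
        rw [div_eq_mul_one_div, abs_mul, abs_mul, abs_of_pos hLi]
        calc _ ≤ |y| * (1 * Lam) := by gcongr
          _ = _ := by ring
      have e2 := (abs_le.1 e1).1
      have e3 := (abs_le.1 haabs).2
      have : Lam * |y| ≤ Lam * |y| ^ p := by gcongr
      linarith
    have hC : p * W ^ (p-1) * (a - y * (dgf δ (x i) / μ i)) ≤ 2 * W ^ (p-1) * (2 * Lam * |y| ^ p) := by
      calc _ ≤ p * W ^ (p-1) * (2 * Lam * |y| ^ p) := by gcongr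
        _ ≤ _ := by gcongr; linarith
    have t1 : 0 ≤ ((Lam / 2) ^ (p-2) * Lam ^ 2 + 20 * Lam + 2 * Lam ^ p) * W ^ (p-1) * |y|^p := by positivity
    have t2 : 0 ≤ ((Lam / 2) ^ (p-2) * Lam ^ 2 + 24 * Lam) * |y|^p := by positivity
    rw [hK]
    linarith

lemma drift_le {m : ℕ} (hm : 1 ≤ m) {μ γ : Fin m → ℝ} (hμ : ∀ i, 0 < μ i) (hγ : ∀ i, 0 < γ i)
    (β : ℝ) : ∃ δ : ℝ, 0 < δ ∧ δ ≤ 1 ∧ ∃ C c : ℝ, 0 ≤ C ∧ 0 < c ∧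
      ∀ x u : Fin m → ℝ, (∀ i, 0 ≤ u i) → ∑ i, u i = 1 →
        ∑ i, dgf δ (x i) / μ i * drift m μ γ β x u i ≤ C - c * Wf m μ δ x := by
  haveI : Nonempty (Fin m) := ⟨⟨0, hm⟩⟩
  have hr : ∀ i, 0 < γ i / μ i := fun i => div_pos (hγ i) (hμ i)
  set Lam := ∑ i, 1 / μ i with hLam
  have hle : ∀ i, 1 / μ i ≤ Lam := fun i =>
    Finset.single_le_sum (f := fun i => 1 / μ i) (fun j _ => (one_div_pos.2 (hμ j)).le) (Finset.mem_univ i)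
  have hLpos : 0 < Lam := lt_of_lt_of_le (one_div_pos.2 (hμ ⟨0, hm⟩)) (hle _)
  obtain ⟨i0, hi0⟩ := Finite.exists_min (fun i => γ i / μ i)
  obtain ⟨i1, hi1⟩ := Finite.exists_max (fun i => γ i / μ i)
  set ε := min (1/2) (γ i0 / μ i0) with hε
  have hεpos : 0 < ε := lt_min (by norm_num) (hr i0)
  have hε2 : ε ≤ 1/2 := min_le_left _ _
  have hεr : ∀ i, ε ≤ γ i / μ i := fun i => (min_le_right _ _).trans (hi0 i)
  set R := γ i1 / μ i1 with hR
  have hRpos : 0 < R := hr i1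
  set δ := 1 / (2 + 2 * R) with hδ
  have h0 : 0 < δ := by positivity
  have h1 : δ ≤ 1 := by rw [hδ, div_le_one (by positivity)]; linarith
  have hδR : δ * R ≤ 1/2 := by
    rw [hδ, div_mul_eq_mul_div, div_le_iff₀ (by positivity)]; linarith
  set c0 := (m : ℝ) / ⨅ i, μ i with hc0
  have hc0pos : 0 ≤ c0 := hLpos.le.trans (lam_le hm hμ)
  have hmpos : (0:ℝ) < m := by exact_mod_cast hm
  refine ⟨δ, h0, h1, |β| + 2 * m + ε / Lam * c0, ε / Lam, by positivity, by positivity, ?_⟩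
  intro x u hu hu1
  set s := max (∑ j, x j) 0 with hs
  have hs0 : 0 ≤ s := le_max_right _ _
  set r : Fin m → ℝ := fun i => max (x i) 0 + δ * max (-(x i)) 0 with hrdef
  have hr0 : ∀ i, 0 ≤ r i := fun i => add_nonneg (le_max_right _ _) (mul_nonneg h0.le (le_max_right _ _))
  have hsr : s ≤ ∑ i, r i := by
    apply max_le
    · refine Finset.sum_le_sum fun i _ => ?_
      have := le_max_left (x i) 0
      have h3 : 0 ≤ δ * max (-(x i)) 0 := mul_nonneg h0.le (le_max_right _ _)
      simp only [hrdef]; linarith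
    · exact Finset.sum_nonneg fun i _ => hr0 i
  have hWle : Wf m μ δ x ≤ c0 + Lam * ∑ i, r i := by
    unfold Wf
    rw [Finset.mul_sum, add_comm, ← hc0]
    gcongr with i _
    rw [div_eq_mul_one_div, mul_comm]
    calc _ ≤ 1 / μ i * r i := mul_le_mul_of_nonneg_left (gf_le h0 _) (one_div_pos.2 (hμ i)).le
      _ ≤ _ := mul_le_mul_of_nonneg_right (hle i) (hr0 i)
  have hterm : ∀ i, dgf δ (x i) / μ i * drift m μ γ β x u i ≤
      |β| / m + (2 - r i) + (1 - ε) * s * u i := by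
    intro i
    have e : dgf δ (x i) / μ i * drift m μ γ β x u i =
        -(β / m) * dgf δ (x i) + -(x i * dgf δ (x i)) + ((1 - γ i / μ i) * dgf δ (x i)) * (s * u i) := by
      unfold drift
      rw [← hs]
      have := (hμ i).ne'
      field_simp
      ring
    rw [e]
    have b1 : -(β / m) * dgf δ (x i) ≤ |β| / m := by
      refine (le_abs_self _).trans ?_
      rw [abs_mul, abs_neg, abs_div, abs_of_pos hmpos]
      exact mul_le_of_le_one_right (by positivity) (dgf_abs h0 h1 _)
    have b2 := mul_dgf h0 h1 (x i)
    have b3 : (1 - γ i / μ i) * dgf δ (x i) ≤ 1 - ε := by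
      have l1 := dgf_le h0 (x i)
      have l2 := dgf_ge h0 (x i)
      have l3 := hεr i
      have l4 : γ i / μ i ≤ R := hi1 i
      have l5 := hr i
      rcases le_total 0 (dgf δ (x i)) with h | h
      · nlinarith
      · nlinarith [mul_le_mul_of_nonneg_left l4 h0.le]
    have b4 := mul_le_mul_of_nonneg_right b3 (mul_nonneg hs0 (hu i))
    simp only [hrdef]
    linarith
  calc ∑ i, dgf δ (x i) / μ i * drift m μ γ β x u i
      ≤ ∑ i, (|β| / m + (2 - r i) + (1 - ε) * s * u i) := Finset.sum_le_sum fun i _ => hterm i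
    _ = |β| + (2 * m - ∑ i, r i) + (1 - ε) * s := by
      rw [Finset.sum_add_distrib, Finset.sum_add_distrib, Finset.sum_sub_distrib, ← Finset.mul_sum, hu1]
      simp
      field_simp
      try ring
    _ ≤ |β| + 2 * m - ε * ∑ i, r i := by nlinarith
    _ ≤ _ := by
      have : ε / Lam * Wf m μ δ x ≤ ε / Lam * (c0 + Lam * ∑ i, r i) := by gcongr
      have e2 : ε / Lam * (c0 + Lam * ∑ i, r i) = ε / Lam * c0 + ε * ∑ i, r i := by
        field_simp
      linarith

/-- Theorem 3 (drift inequality): if `γ_i > 0` for all `i`, `α ∈ (1,2)` and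
`p ∈ [1,α)`, then there exist `δ ∈ (0,1]` and positive constants `κ̃₀, κ̃₁` with
`⟨b(x,u), ∇V_p(x)⟩ + I_α V_p(x) ≤ κ̃₀ - κ̃₁ V_p(x)` for all `x ∈ ℝ^m`, `u ∈ Δ`. -/
theorem stmt_10 (m : ℕ) (hm : 1 ≤ m) (μ γ ξ : Fin m → ℝ)
    (hμ : ∀ i, 0 < μ i) (hγ : ∀ i, 0 < γ i) (hξ : ∀ i, 0 < ξ i)
    (β : ℝ)
    (α : ℝ) (hα1 : 1 < α) (hα2 : α < 2)
    (p : ℝ) (hp1 : 1 ≤ p) (hpα : p < α) :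
    ∃ δ : ℝ, 0 < δ ∧ δ ≤ 1 ∧ ∃ κ₀ κ₁ : ℝ, 0 < κ₀ ∧ 0 < κ₁ ∧
      ∀ x u : Fin m → ℝ, (∀ i, 0 ≤ u i) → ∑ i, u i = 1 →
        fderiv ℝ (Vp m μ δ p) x (drift m μ γ β x u) + Ialpha m α ξ (Vp m μ δ p) x ≤
          κ₀ - κ₁ * Vp m μ δ p x := by
  obtain ⟨δ, h0, h1, C, c, hC, hc, hdr⟩ := drift_le hm hμ hγ β
  obtain ⟨K, hK, hIa⟩ := Ialpha_le hm hμ hξ hα2 hp1 hpα h0 h1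
  set D := p * C + K with hD
  have hp0 : 0 < p := by linarith
  have hD0 : 0 ≤ D := by positivity
  set κ := p * c / 2 with hκ
  have hκ0 : 0 < κ := by positivity
  refine ⟨δ, h0, h1, K + D * (D / κ) ^ (p - 1) + 1, κ, by positivity, hκ0, ?_⟩
  intro x u hu hu1
  have hLpos : 0 < ∑ i, 1 / μ i := by
    haveI : Nonempty (Fin m) := ⟨⟨0, hm⟩⟩
    exact Finset.sum_pos (fun i _ => one_div_pos.2 (hμ i)) Finset.univ_nonempty
  have hW : 0 < Wf m μ δ x := by
    have := Wf_ge hm hμ h0 h1 x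
    linarith
  rw [hasFDerivAt_Vp x hW]
  have a1 := hIa x
  have a2 := hdr x u hu hu1
  rw [show Vp m μ δ p x = Wf m μ δ x ^ p by rw [Vp_eq]]
  set W := Wf m μ δ x
  have e : W ^ p = W ^ (p - 1) * W := by
    rw [← Real.rpow_add_one hW.ne']; congr 1; ring
  have hA : 0 ≤ W ^ (p - 1) := by positivity
  have a3 := mul_le_mul_of_nonneg_left a2 (mul_nonneg hp0.le hA)
  have key : W ^ (p-1) * (D - κ * W) ≤ D * (D / κ) ^ (p - 1) := by
    rcases le_total (D / κ) W with h | h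
    · rw [div_le_iff₀ hκ0] at h
      have : W ^ (p-1) * (D - κ * W) ≤ 0 := mul_nonpos_of_nonneg_of_nonpos hA (by linarith)
      exact this.trans (by positivity)
    · have h5 : W ^ (p-1) ≤ (D / κ) ^ (p-1) := Real.rpow_le_rpow hW.le h (by linarith)
      calc W ^ (p-1) * (D - κ * W) ≤ W ^ (p-1) * D := by
            apply mul_le_mul_of_nonneg_left _ hA
            nlinarith
        _ ≤ (D / κ) ^ (p-1) * D := by gcongr
        _ = _ := by ring
  rw [e]
  have e5 : p * W ^ (p-1) * (C - c * W) + K * (1 + W ^ (p-1)) =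
      K + W ^ (p-1) * (D - κ * W) - κ * (W ^ (p-1) * W) := by
    rw [hD, hκ]; ring
  linarith

end
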